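/- Let c be a continuous real-valued function on the unit circle {ζ ∈ ℂ : |ζ| = 1}. Suppose there exists a complex-valued function G, continuous on the closed unit disc and holomorphic on the open unit disc, such that G(ζ) = ζ c(ζ) for every ζ with |ζ| = 1. Then there exist a ∈ ℂ and b ∈ ℝ such that c(ζ) = a conj(ζ) + b + conj(a) ζ for every ζ with |ζ| = 1. -/

import Mathlib

open Metric in
/-- A function that is holomorphic on the unit disc, continuous up to the boundary and has
nonpositive imaginary part on the unit circle has nonpositive imaginary part on the disc. -/
lemma DiffContOnCl.im_nonpos_of_sphere {K : ℂ → ℂ} (hK : DiffContOnCl ℂ K (ball 0 1))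
    (him : ∀ ζ ∈ sphere (0 : ℂ) 1, (K ζ).im ≤ 0) {z : ℂ} (hz : z ∈ ball (0 : ℂ) 1) :
    (K z).im ≤ 0 := by
  have hd : DiffContOnCl ℂ (fun z ↦ Complex.exp (-Complex.I * K z)) (ball 0 1) :=
    Complex.differentiable_exp.comp_diffContOnCl (hK.const_smul (-Complex.I))
  have h := Complex.norm_le_of_forall_mem_frontier_norm_le isBounded_ball hd (C := 1)
    (fun ζ hζ ↦ by
      rw [frontier_ball _ one_ne_zero] at hζ
      simpa [Complex.norm_exp] using him ζ hζ) (subset_closure hz)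
  simpa [Complex.norm_exp] using h

open Metric in
/-- A function that is holomorphic on the unit disc, continuous up to the boundary and real on the
unit circle is constant. -/
lemma DiffContOnCl.exists_eq_const_of_im_sphere_eq_zero {K : ℂ → ℂ}
    (hK : DiffContOnCl ℂ K (ball 0 1)) (him : ∀ ζ ∈ sphere (0 : ℂ) 1, (K ζ).im = 0) :
    ∃ w, ∀ ζ ∈ closedBall (0 : ℂ) 1, K ζ = w := by
  have him_ball : ∀ z ∈ ball (0 : ℂ) 1, (K z).im = 0 := fun z hz ↦ by
    refine le_antisymm (hK.im_nonpos_of_sphere (fun ζ hζ ↦ (him ζ hζ).le) hz) ?_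
    simpa using hK.neg.im_nonpos_of_sphere (fun ζ hζ ↦ by simp [him ζ hζ]) hz
  obtain ⟨w, hw⟩ := (hK.differentiableOn.analyticOnNhd isOpen_ball).eq_const_of_im_eq_const
    him_ball isOpen_ball ⟨nonempty_ball.2 one_pos, (convex_ball 0 1).isPreconnected⟩
  refine ⟨w, fun ζ hζ ↦ ?_⟩
  rw [← closure_ball _ one_ne_zero] at hζ
  exact Set.EqOn.of_subset_closure (g := fun _ ↦ w) hw hK.continuousOn continuousOn_const
    subset_closure subset_rfl hζ

/-- Let `c` be a continuous real-valued function on the unit circle.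
If there is a complex-valued `G`, continuous on the closed unit disc and holomorphic on
the open unit disc, with `G(ζ) = ζ c(ζ)` on the unit circle, then there are `a ∈ ℂ` and
`b ∈ ℝ` with `c(ζ) = a conj(ζ) + b + conj(a) ζ` on the unit circle. -/
theorem stmt15 (c : ℂ → ℝ)
    (hc : ContinuousOn c (Metric.sphere (0 : ℂ) 1))
    (hG : ∃ G : ℂ → ℂ,
      ContinuousOn G (Metric.closedBall 0 1) ∧
      DifferentiableOn ℂ G (Metric.ball 0 1) ∧
      ∀ ζ ∈ Metric.sphere (0 : ℂ) 1, G ζ = ζ * (c ζ : ℂ)) :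
    ∃ (a : ℂ) (b : ℝ), ∀ ζ ∈ Metric.sphere (0 : ℂ) 1,
      (c ζ : ℂ) = a * starRingEnd ℂ ζ + (b : ℂ) + starRingEnd ℂ a * ζ := by
  obtain ⟨G, hGc, hGd, hGs⟩ := hG
  set a := G 0 with ha
  set H : ℂ → ℂ := fun ζ ↦ G ζ - a - starRingEnd ℂ a * ζ ^ 2 with hH
  have hHc : ContinuousOn H (Metric.closedBall 0 1) := by fun_prop
  have hHd : DifferentiableOn ℂ H (Metric.ball 0 1) := by fun_prop
  have hball : Metric.ball (0 : ℂ) 1 ∈ nhds 0 := Metric.ball_mem_nhds _ one_pos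
  have hclosed : Metric.closedBall (0 : ℂ) 1 ∈ nhds 0 := Metric.closedBall_mem_nhds _ one_pos
  have hK : DiffContOnCl ℂ (dslope H 0) (Metric.ball 0 1) := by
    refine ⟨(Complex.differentiableOn_dslope hball).2 hHd, ?_⟩
    rw [closure_ball _ one_ne_zero]
    exact (continuousOn_dslope hclosed).2 ⟨hHc, hHd.differentiableAt hball⟩
  have hKs : ∀ ζ ∈ Metric.sphere (0 : ℂ) 1,
      dslope H 0 ζ = c ζ - (a * starRingEnd ℂ ζ + starRingEnd ℂ a * ζ) := by
    intro ζ hζ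
    have hne : ζ ≠ 0 := ne_zero_of_mem_unit_sphere ⟨ζ, hζ⟩
    have hmul : ζ * starRingEnd ℂ ζ = 1 := by
      rw [Complex.mul_conj', mem_sphere_zero_iff_norm.mp hζ]
      norm_num
    rw [dslope_of_ne _ hne, slope_def_field, sub_zero, div_eq_iff hne]
    simp only [hH, hGs ζ hζ, ← ha]
    linear_combination a * hmul
  obtain ⟨w, hw⟩ := hK.exists_eq_const_of_im_sphere_eq_zero fun ζ hζ ↦ by
    rw [hKs ζ hζ]
    simp only [Complex.sub_im, Complex.add_im, Complex.mul_im, Complex.ofReal_im,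
      Complex.conj_re, Complex.conj_im]
    ring
  refine ⟨a, w.re, fun ζ hζ ↦ ?_⟩
  have h := hw ζ (Metric.sphere_subset_closedBall hζ)
  rw [hKs ζ hζ] at h
  have hwre : (w.re : ℂ) = w := by
    rw [← h]
    apply Complex.ext
    · simp
    · simp
      ring
  rw [hwre, ← h]
  ring
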